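/- arXiv:1807.09348 — 2 statements merged into one kernel-verified Lean document; each statement's English description precedes it below -/
import Mathlib

section
/- Every (X,M)-graph G with G(V) nonempty admits an injective hull: there exists a monomorphism i : G → Q such that Q is an injective object, i is bijective on vertices, and i is essential, i.e. for every morphism h : Q → H, if h∘i is a monomorphism then h is a monomorphism. -/
open CategoryTheory Limits Opposite

/-- The two objects of the theory for `(X,M)`-graphs. -/
inductive Th (M X : Type) : Type
  | V | A

namespace Th

variable (M X : Type) [Monoid M] [MulAction Mᵐᵒᵖ X]

/-- Hom-sets of the theory. -/
def Homs (M X : Type) : Th M X → Th M X → Type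
  | V, V => PUnit
  | V, A => X
  | A, V => PEmpty
  | A, A => M

instance : Category (Th M X) where
  Hom := Homs M X
  id o := match o with
    | V => PUnit.unit
    | A => (1 : M)
  comp {a b c} f g := match a, b, c, f, g with
    | V, V, V, _, _ => PUnit.unit
    | V, V, A, _, x => x
    | V, A, V, _, e => e.elim
    | V, A, A, x, m => show X from MulOpposite.op (show M from m) • (show X from x)
    | A, V, _, e, _ => e.elim
    | A, A, V, _, e => e.elim
    | A, A, A, m, m' => show M from (show M from m) * (show M from m')
  id_comp {a b} f := by
    cases a <;> cases b <;>
      first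
        | exact f.elim
        | rfl
        | exact one_mul (show M from f)
  comp_id {a b} f := by
    cases a <;> cases b <;>
      first
        | exact f.elim
        | rfl
        | exact mul_one (show M from f)
        | exact one_smul Mᵐᵒᵖ (show X from f)
  assoc {a b c d} f g h := by
    cases a <;> cases b <;> cases c <;> cases d <;>
      first
        | exact f.elim
        | exact g.elim
        | exact h.elim
        | rfl
        | exact mul_assoc (show M from f) (show M from g) (show M from h)
        | exact (mul_smul (MulOpposite.op (show M from h)) (MulOpposite.op (show M from g)) (show X from f)).symm

/-- The element `x : X` seen as a morphism `V ⟶ A` of the theory. -/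
def arc {M X : Type} [Monoid M] [MulAction Mᵐᵒᵖ X] (x : X) : (V : Th M X) ⟶ A := x

end Th

namespace InjHull

variable {D : Type} [Category.{0} D]

lemma mono_iff_inj {F F' : D ⥤ Type} (f : F ⟶ F') :
    Mono f ↔ ∀ d (a b : F.obj d), f.app d a = f.app d b → a = b := by
  rw [NatTrans.mono_iff_mono_app]
  refine forall_congr' fun d => ?_
  rw [CategoryTheory.mono_iff_injective]
  rfl

/-- Cofree functor. -/
def cofree (S : D → Type) : D ⥤ Type where
  obj d := ∀ d', (d ⟶ d') → S d'
  map f := ↾fun e d' g => e d' (f ≫ g)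
  map_id d := by ext e d' g; exact congrArg (e d') (Category.id_comp g)
  map_comp f g := by ext e d' k; exact congrArg (e d') (Category.assoc f g k)

/-- Map into the cofree functor. -/
def toCofree {S : D → Type} {F : D ⥤ Type} (σ : ∀ d, F.obj d → S d) : F ⟶ cofree S where
  app d := ↾fun x d' g => σ d' (F.map g x)
  naturality d d' f := by
    ext x; funext e g
    simp [cofree]

lemma toCofree_app {S : D → Type} {F : D ⥤ Type} (σ : ∀ d, F.obj d → S d) (d : D)
    (x : F.obj d) (d' : D) (g : d ⟶ d') : (toCofree σ).app d x d' g = σ d' (F.map g x) := rfl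

lemma cofree_nat {S : D → Type} {F : D ⥤ Type} (g : F ⟶ cofree S) {d d' : D} (k : d ⟶ d')
    (x : F.obj d) : g.app d' (F.map k x) d' (𝟙 _) = g.app d x d' k := by
  have h := NatTrans.naturality_apply g k x
  have h2 := congrFun (congrFun h d') (𝟙 _)
  refine h2.trans ?_
  show g.app d x d' (k ≫ 𝟙 _) = _
  rw [Category.comp_id]

lemma cofree_injective (S : D → Type) (hS : ∀ d, Nonempty (S d)) : Injective (cofree S) := by
  classical
  refine ⟨fun {A B} g f hf => ?_⟩
  rw [mono_iff_inj] at hf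
  have : ∀ d, ∃ σ : B.obj d → S d, ∀ a, σ (f.app d a) = g.app d a d (𝟙 _) := by
    intro d
    refine ⟨fun b => if h : ∃ a, f.app d a = b then g.app d h.choose d (𝟙 _)
      else (hS d).some, fun a => ?_⟩
    have h : ∃ a', f.app d a' = f.app d a := ⟨a, rfl⟩
    simp only [dif_pos h]
    rw [hf d _ _ h.choose_spec]
  choose σ hσ using this
  refine ⟨toCofree σ, ?_⟩
  ext d x
  funext d' k
  show σ d' (B.map k (f.app d x)) = _
  rw [← NatTrans.naturality_apply f k x, hσ, cofree_nat]
  rfl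

/-- Quotient functor. -/
def quot (F : D ⥤ Type) (r : ∀ d, Setoid (F.obj d))
    (hr : ∀ {d d'} (f : d ⟶ d') a b, (r d).r a b → (r d').r (F.map f a) (F.map f b)) :
    D ⥤ Type where
  obj d := Quotient (r d)
  map f := ↾(Quotient.map (F.map f) (fun a b h => hr f a b h))
  map_id d := by
    ext x; induction x using Quotient.inductionOn; simp
  map_comp f g := by
    ext x; induction x using Quotient.inductionOn; simp

/-- Projection. -/
def quotMk (F : D ⥤ Type) (r : ∀ d, Setoid (F.obj d))
    (hr : ∀ {d d'} (f : d ⟶ d') a b, (r d).r a b → (r d').r (F.map f a) (F.map f b)) :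
    F ⟶ quot F r hr where
  app d := ↾(Quotient.mk (r d))
  naturality d d' f := by ext x; rfl

/-- Essential morphisms. -/
def Ess {F F' : D ⥤ Type} (i : F ⟶ F') : Prop :=
  ∀ (H : D ⥤ Type) (h : F' ⟶ H), Mono (i ≫ h) → Mono h

lemma exists_quot {Q E : D ⥤ Type} (q : Q ⟶ E) [Mono q] :
    ∃ (P : D ⥤ Type) (p : E ⟶ P), (∀ d, Function.Surjective (p.app d)) ∧
      Mono (q ≫ p) ∧ Ess (q ≫ p) := by
  have hq := (mono_iff_inj q).1 inferInstance
  let s : Set (∀ d, E.obj d → E.obj d → Prop) := {R | (∀ d, Equivalence (R d)) ∧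
    (∀ (d d' : D) (f : d ⟶ d') a b, R d a b → R d' (E.map f a) (E.map f b)) ∧
    (∀ d (a b : Q.obj d), R d (q.app d a) (q.app d b) → a = b)}
  obtain ⟨R, -, hR⟩ := zorn_le_nonempty₀ s (by
    intro c hc hch y hy
    have hle : ∀ z ∈ c, z ≤ fun d a b => ∃ R ∈ c, R d a b := fun z hz d a b h => ⟨z, hz, h⟩
    refine ⟨fun d a b => ∃ R ∈ c, R d a b, ⟨fun d => ⟨?_, ?_, ?_⟩, ?_, ?_⟩, hle⟩
    · exact fun x => ⟨y, hy, ((hc hy).1 d).refl x⟩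
    · rintro a b ⟨R, h, h'⟩
      exact ⟨R, h, ((hc h).1 d).symm h'⟩
    · rintro a b e ⟨R, h, h'⟩ ⟨T, k, k'⟩
      rcases hch.total h k with l | l
      · exact ⟨T, k, ((hc k).1 d).trans (l _ _ _ h') k'⟩
      · exact ⟨R, h, ((hc h).1 d).trans h' (l _ _ _ k')⟩
    · rintro d d' f a b ⟨R, h, h'⟩
      exact ⟨R, h, (hc h).2.1 _ _ f _ _ h'⟩
    · rintro d a b ⟨R, h, h'⟩
      exact (hc h).2.2 _ _ _ h') (fun d a b => a = b)
    ⟨fun d => eq_equivalence, by rintro d d' f a _ rfl; rfl, fun d a b h => hq d a b h⟩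
  let r : ∀ d, Setoid (E.obj d) := fun d => ⟨R d, hR.prop.1 d⟩
  refine ⟨quot E r (fun f a b h => hR.prop.2.1 _ _ f a b h),
    quotMk E r (fun f a b h => hR.prop.2.1 _ _ f a b h), ?_, ?_, ?_⟩
  · exact fun d => Quotient.mk_surjective
  · rw [mono_iff_inj]
    intro d a b h
    exact hR.prop.2.2 d a b (Quotient.exact (s := r d) h)
  · intro H h hm
    rw [mono_iff_inj] at hm ⊢
    set p := quotMk E r (fun f a b h => hR.prop.2.1 _ _ f a b h) with hp
    have key : (fun d a b => h.app d (p.app d a) = h.app d (p.app d b)) ≤ R := by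
      apply hR.le_of_ge
      · refine ⟨fun d => ⟨fun _ => rfl, fun h => h.symm, fun h h' => h.trans h'⟩, ?_, ?_⟩
        · intro d d' f a b hab
          simp only [NatTrans.naturality_apply] at hab ⊢
          rw [hab]
        · exact fun d a b hab => hm d a b hab
      · intro d a b hab
        exact congrArg (h.app d) (Quotient.sound (s := r d) hab)
    intro d a b hab
    induction a using Quotient.inductionOn with | _ a
    induction b using Quotient.inductionOn with | _ b
    exact Quotient.sound (s := r d) (key d a b hab)

lemma exists_hull {G E : D ⥤ Type} (i : G ⟶ E) [Mono i] [Injective E] :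
    ∃ (Q : D ⥤ Type) (j : G ⟶ Q) (k : Q ⟶ E), j ≫ k = i ∧ Mono k ∧ Injective Q ∧ Ess j := by
  let s : Set (Subfunctor E) :=
    {Q | ∃ h : Subfunctor.range i ≤ Q, Ess (Subfunctor.lift i h)}
  obtain ⟨Q, -, hQ⟩ := zorn_le_nonempty₀ s (by
    intro c hc hch y hy
    refine ⟨sSup c, ⟨(hc hy).1.trans (le_sSup hy), ?_⟩, fun z hz => le_sSup hz⟩
    intro H h hm
    have hz : ∀ z (hz : z ∈ c), Mono (Subfunctor.homOfLe (le_sSup hz) ≫ h) := by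
      intro z hz
      exact (hc hz).2 H _ hm
    rw [mono_iff_inj]
    rintro d ⟨a, ha⟩ ⟨b, hb⟩ hab
    obtain ⟨_, ⟨S, hS, rfl⟩, ha'⟩ := id ha
    obtain ⟨_, ⟨T, hT, rfl⟩, hb'⟩ := id hb
    have fin : ∀ z ∈ c, a ∈ z.obj d → b ∈ z.obj d → a = b := by
      intro z h1 h2 h3
      have := (mono_iff_inj _).1 (hz z h1) d ⟨a, h2⟩ ⟨b, h3⟩ hab
      exact congrArg Subtype.val this
    apply Subtype.ext
    rcases hch.total hS hT with l | l
    · exact fin T hT (l d ha') hb'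
    · exact fin S hS ha' (l d hb'))
    (Subfunctor.range i) ⟨le_rfl, by
      intro H h hm
      rw [mono_iff_inj] at hm ⊢
      rintro d ⟨_, a, rfl⟩ ⟨_, b, rfl⟩ hab
      have := hm d a b hab
      subst this; rfl⟩
  obtain ⟨hle, hess⟩ := hQ.prop
  obtain ⟨P, p, hps, hpm, hpe⟩ := exists_quot Q.ι
  let t : P ⟶ E := Injective.factorThru Q.ι (Q.ι ≫ p)
  have ht : (Q.ι ≫ p) ≫ t = Q.ι := Injective.comp_factorThru _ _
  have htm : Mono t := hpe _ t (by rw [ht]; infer_instance)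
  have hQr : Q ≤ Subfunctor.range t := by
    intro d x hx
    exact ⟨p.app d x, congrArg (fun f => f.app d ⟨x, hx⟩) ht⟩
  have hrQ : Subfunctor.range t ≤ Q := by
    apply hQ.le_of_ge _ hQr
    refine ⟨hle.trans hQr, ?_⟩
    intro H h hm
    have h1 : Mono (Subfunctor.homOfLe hQr ≫ h) := hess H _ hm
    have h2 : Mono (Subfunctor.toRange t ≫ h) := by
      apply hpe
      have : (Q.ι ≫ p) ≫ Subfunctor.toRange t = Subfunctor.homOfLe hQr := by
        rw [← cancel_mono (Subfunctor.range t).ι]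
        simpa using ht
      rw [← Category.assoc, this]
      exact h1
    rw [mono_iff_inj] at h2 ⊢
    rintro d ⟨_, a, rfl⟩ ⟨_, b, rfl⟩ hab
    have := h2 d a b hab
    subst this; rfl
  refine ⟨Q.toFunctor, Subfunctor.lift i hle, Q.ι, Subfunctor.lift_ι _ _, inferInstance, ?_, hess⟩
  let ρ : E ⟶ Q.toFunctor := p ≫ Subfunctor.lift t hrQ
  have hρ : Q.ι ≫ ρ = 𝟙 _ := by
    rw [← cancel_mono Q.ι]
    simpa [ρ] using ht
  refine ⟨fun {A B} g f hf => ⟨Injective.factorThru (g ≫ Q.ι) f ≫ ρ, ?_⟩⟩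
  rw [← Category.assoc, Injective.comp_factorThru, Category.assoc, hρ, Category.comp_id]

end InjHull

open Th in
/-- Every `(X,M)`-graph `G` with `G(V)` nonempty admits an injective hull:
a monomorphism `i : G ⟶ Q` with `Q` injective, `i` bijective on vertices, and `i` essential. -/
theorem statement6 (M X : Type) [Monoid M] [MulAction Mᵐᵒᵖ X]
    (G : (Th M X)ᵒᵖ ⥤ Type) (hG : Nonempty (G.obj (op V))) :
    ∃ (Q : (Th M X)ᵒᵖ ⥤ Type) (i : G ⟶ Q),
      Mono i ∧ Injective Q ∧
      Function.Bijective (i.app (op V)) ∧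
      (∀ (H : (Th M X)ᵒᵖ ⥤ Type) (h : Q ⟶ H), Mono (i ≫ h) → Mono h) := by
  have hS : ∃ (S : (Th M X)ᵒᵖ → Type) (σ : ∀ d, G.obj d → S d), (∀ d, Nonempty (S d)) ∧
      (∀ d, Function.Injective (σ d)) ∧ Function.Surjective (σ (op V)) := by
    refine ⟨fun d => match d with
      | ⟨V⟩ => G.obj (op V)
      | ⟨A⟩ => Option (G.obj (op A)), fun d => match d with
      | ⟨V⟩ => id
      | ⟨A⟩ => some, ?_, ?_, ?_⟩
    · rintro ⟨_ | _⟩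
      · exact hG
      · exact ⟨none⟩
    · rintro ⟨_ | _⟩
      · exact Function.injective_id
      · exact Option.some_injective _
    · exact Function.surjective_id
  obtain ⟨S, σ, hne, hinj, hsurj⟩ := hS
  have hm : Mono (InjHull.toCofree σ) := by
    rw [InjHull.mono_iff_inj]
    intro d a b hab
    have := congrFun (congrFun hab d) (𝟙 d)
    rw [InjHull.toCofree_app, InjHull.toCofree_app] at this
    simpa using hinj d this
  have := InjHull.cofree_injective S hne
  obtain ⟨Q, j, k, hjk, hk, hQ, he⟩ := InjHull.exists_hull (InjHull.toCofree σ)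
  have hj : Mono j := by
    rw [← hjk] at hm
    exact mono_of_mono j k
  refine ⟨Q, j, hj, hQ, ⟨fun a b h => (InjHull.mono_iff_inj j).1 hj _ a b h, ?_⟩, he⟩
  intro y
  obtain ⟨x, hx⟩ := hsurj (k.app _ y (op V) (𝟙 _))
  refine ⟨x, (InjHull.mono_iff_inj k).1 hk _ _ _ ?_⟩
  have h1 : k.app (op V) (j.app (op V) x) = (InjHull.toCofree σ).app (op V) x := by
    rw [← hjk]; rfl
  rw [h1]
  funext d g
  rw [InjHull.toCofree_app]
  obtain ⟨_ | _⟩ := d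
  · have hg : g = 𝟙 _ := rfl
    rw [hg]
    simpa using hx
  · exact PEmpty.elim g.unop
end

section
/- A hypergraph Q is an injective object of the category of hypergraphs if and only if Q(V) is nonempty and for every subset S ⊆ Q(V) there exists an edge e ∈ Q(E) with incidence φ_Q(e) = S. -/
open CategoryTheory Limits Opposite

/-- A hypergraph: a set of edges, a set of vertices, and an incidence map
`inc : E → 𝒫(V)`.  This is an object of the comma category `Set ↓ 𝒫` for the
covariant powerset functor `𝒫`. -/
structure HG : Type 1 where
  E : Type
  Vt : Type
  inc : E → Set Vt

/-- A morphism of hypergraphs `(f_E, f_V)` with `φ' ∘ f_E = 𝒫(f_V) ∘ φ`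
(the powerset functor acts by taking images). -/
@[ext]
structure HGHom (H K : HG) : Type where
  fE : H.E → K.E
  fV : H.Vt → K.Vt
  comm : ∀ e, K.inc (fE e) = fV '' (H.inc e)

instance : Category HG where
  Hom := HGHom
  id H := ⟨id, id, fun e => by simp⟩
  comp {H K L} f g := ⟨g.fE ∘ f.fE, g.fV ∘ f.fV, fun e => by
    simp only [Function.comp_apply, g.comm, f.comm, Set.image_image]⟩
  id_comp f := HGHom.ext rfl rfl
  comp_id f := HGHom.ext rfl rfl
  assoc f g h := HGHom.ext rfl rfl

theorem HG.mono_of_inj {H K : HG} (f : HGHom H K) (hE : Function.Injective f.fE)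
    (hV : Function.Injective f.fV) : Mono (show H ⟶ K from f) := by
  constructor
  intro Z g h w
  have w1 : f.fE ∘ (g : HGHom Z H).fE = f.fE ∘ (h : HGHom Z H).fE := congrArg HGHom.fE w
  have w2 : f.fV ∘ (g : HGHom Z H).fV = f.fV ∘ (h : HGHom Z H).fV := congrArg HGHom.fV w
  exact HGHom.ext (hE.comp_left w1) (hV.comp_left w2)

theorem HG.injV_of_mono {H K : HG} (f : H ⟶ K) [Mono f] :
    Function.Injective (HGHom.fV f) := by
  intro a b hab
  let Z : HG := ⟨Empty, Unit, fun e => e.elim⟩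
  let g : Z ⟶ H := (⟨fun e => e.elim, fun _ => a, fun e => e.elim⟩ : HGHom Z H)
  let h : Z ⟶ H := (⟨fun e => e.elim, fun _ => b, fun e => e.elim⟩ : HGHom Z H)
  have w : g ≫ f = h ≫ f := HGHom.ext (funext fun e => e.elim) (funext fun _ => hab)
  have := (cancel_mono f).1 w
  exact congrFun (congrArg HGHom.fV this) ()

theorem HG.injE_of_mono {H K : HG} (f : H ⟶ K) [Mono f] :
    Function.Injective (HGHom.fE f) := by
  intro a b hab
  have hinc : H.inc a = H.inc b := by
    apply (HG.injV_of_mono f).image_injective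
    rw [← HGHom.comm f, ← HGHom.comm f, hab]
  let Z : HG := ⟨Unit, H.Vt, fun _ => H.inc a⟩
  let g : Z ⟶ H := (⟨fun _ => a, id, fun _ => by simp [Z]⟩ : HGHom Z H)
  let h : Z ⟶ H := (⟨fun _ => b, id, fun _ => by simp [Z, hinc]⟩ : HGHom Z H)
  have w : g ≫ f = h ≫ f := HGHom.ext (funext fun _ => hab) rfl
  have := (cancel_mono f).1 w
  exact congrFun (congrArg HGHom.fE this) ()

/-- A hypergraph `Q` is an injective object of the category of hypergraphs
iff `Q(V)` is nonempty and every subset `S ⊆ Q(V)` is the incidence of some edge. -/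
theorem statement13 (Q : HG) :
    Injective Q ↔
      (Nonempty Q.Vt ∧ ∀ S : Set Q.Vt, ∃ e : Q.E, Q.inc e = S) := by
  constructor
  · intro hQ
    constructor
    · let X : HG := ⟨Empty, Empty, fun e => e.elim⟩
      let Y : HG := ⟨Empty, Unit, fun e => e.elim⟩
      let g : X ⟶ Q := (⟨fun e => e.elim, fun e => e.elim, fun e => e.elim⟩ : HGHom X Q)
      let f : HGHom X Y := ⟨fun e => e.elim, fun e => e.elim, fun e => e.elim⟩
      have := HG.mono_of_inj f (fun e => e.elim) (fun e => e.elim)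
      obtain ⟨h, -⟩ := hQ.factors g (show X ⟶ Y from f)
      exact ⟨HGHom.fV h ()⟩
    · intro S
      let X : HG := ⟨Empty, Q.Vt, fun e => e.elim⟩
      let Y : HG := ⟨Unit, Q.Vt, fun _ => S⟩
      let g : X ⟶ Q := (⟨fun e => e.elim, id, fun e => e.elim⟩ : HGHom X Q)
      let f : HGHom X Y := ⟨fun e => e.elim, id, fun e => e.elim⟩
      have := HG.mono_of_inj f (fun e => e.elim) (fun _ _ h => h)
      obtain ⟨h, hh⟩ := hQ.factors g (show X ⟶ Y from f)
      have hid : HGHom.fV h = id := congrArg HGHom.fV hh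
      refine ⟨HGHom.fE h (), ?_⟩
      rw [HGHom.comm h, hid]
      exact Set.image_id S
  · rintro ⟨⟨v⟩, hS⟩
    choose c hc using hS
    constructor
    intro X Y g f _
    have iV := HG.injV_of_mono f
    have iE := HG.injE_of_mono f
    let hV : Y.Vt → Q.Vt := Function.extend (HGHom.fV f) (HGHom.fV g) (fun _ => v)
    let hE : Y.E → Q.E := Function.extend (HGHom.fE f) (HGHom.fE g)
      (fun e => c (hV '' Y.inc e))
    have hVf : ∀ x, hV (HGHom.fV f x) = HGHom.fV g x := fun x => iV.extend_apply _ _ x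
    have hEf : ∀ x, hE (HGHom.fE f x) = HGHom.fE g x := fun x => iE.extend_apply _ _ x
    refine ⟨(⟨hE, hV, ?_⟩ : HGHom Y Q), HGHom.ext (funext hEf) (funext hVf)⟩
    intro e
    by_cases he : ∃ a, HGHom.fE f a = e
    · obtain ⟨a, rfl⟩ := he
      rw [hEf, HGHom.comm g, HGHom.comm f, Set.image_image]
      simp only [hVf]
    · have : hE e = c (hV '' Y.inc e) := Function.extend_apply' _ _ _ he
      rw [this, hc]
end
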